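/- The su_q^P(3) coproduct respects the Serre-type brackets: as functions on ℝ⁹×ℝ⁹ one has {Δ(a₁₂), Δ(a₁₃)} = z²·Δ(a₁₂)²·Δ(a₂₃), {Δ(a₁₃), Δ(a₂₃)} = z²·Δ(a₂₃)²·Δ(a₁₂), {Δ(a₃₁), Δ(a₂₁)} = z²·Δ(a₂₁)²·Δ(a₃₂), {Δ(a₃₂), Δ(a₃₁)} = z²·Δ(a₃₂)²·Δ(a₂₁), and moreover {Δ(a₂₃), Δ(a₂₁)} = 0 and {Δ(a₁₂), Δ(a₃₂)} = 0, where the brackets on the left are the product Poisson bracket. -/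

import Mathlib

/-- Partial derivative of a function on ℝ⁹ in the `i`-th coordinate direction.
Coordinates: (x 0,…,x 8) = (h₁,h₂,h₃,a₁₂,a₂₁,a₂₃,a₃₂,a₁₃,a₃₁). -/
noncomputable def pd (i : Fin 9) (f : (Fin 9 → ℝ) → ℝ) (x : Fin 9 → ℝ) : ℝ :=
  fderiv ℝ f x (Pi.single i 1)

/-- The structure functions π(u,v) of su_q^P(3) for u < v (zero otherwise);
indices: 0=h₁, 1=h₂, 2=h₃, 3=a₁₂, 4=a₂₁, 5=a₂₃, 6=a₃₂, 7=a₁₃, 8=a₃₁. -/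
noncomputable def piU (z : ℝ) (u v : ℕ) (x : Fin 9 → ℝ) : ℝ :=
  match u, v with
  | 0, 3 => x 3
  | 0, 4 => -x 4
  | 0, 7 => x 7
  | 0, 8 => -x 8
  | 1, 3 => -x 3
  | 1, 4 => x 4
  | 1, 5 => x 5
  | 1, 6 => -x 6
  | 2, 5 => -x 5
  | 2, 6 => x 6
  | 2, 7 => -x 7
  | 2, 8 => x 8
  | 3, 4 => Real.sinh (z * (x 0 - x 1)) / z
  | 3, 5 => x 7
  | 3, 7 => z ^ 2 * x 3 ^ 2 * x 5
  | 3, 8 => -(Real.cosh (z * (x 0 - x 1)) * x 6)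
  | 4, 6 => -x 8
  | 4, 7 => Real.cosh (z * (x 0 - x 1)) * x 5
  | 4, 8 => -(z ^ 2 * x 4 ^ 2 * x 6)
  | 5, 6 => Real.sinh (z * (x 1 - x 2)) / z
  | 5, 7 => -(z ^ 2 * x 5 ^ 2 * x 3)
  | 5, 8 => Real.cosh (z * (x 1 - x 2)) * x 4
  | 6, 7 => -(Real.cosh (z * (x 1 - x 2)) * x 3)
  | 6, 8 => z ^ 2 * x 6 ^ 2 * x 4
  | 7, 8 => Real.sinh (z * (x 0 - x 2)) / z
      + z * Real.sinh (z * (x 0 - x 1)) * x 5 * x 6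
      + z * Real.sinh (z * (x 1 - x 2)) * x 3 * x 4
  | _, _ => 0

/-- The bracket of the q-Poisson algebra su_q^P(3):
{f,g} = Σ_{u<v} π(u,v)(∂_u f ∂_v g − ∂_v f ∂_u g). -/
noncomputable def suq3Bracket (z : ℝ) (f g : (Fin 9 → ℝ) → ℝ) (x : Fin 9 → ℝ) : ℝ :=
  ∑ u : Fin 9, ∑ v : Fin 9,
    if u < v then piU z u.val v.val x * (pd u f x * pd v g x - pd v f x * pd u g x)
    else 0

/-- The product Poisson bracket on ℝ⁹ × ℝ⁹. -/
noncomputable def suq3Bracket2 (z : ℝ) (F G : (Fin 9 → ℝ) × (Fin 9 → ℝ) → ℝ)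
    (p : (Fin 9 → ℝ) × (Fin 9 → ℝ)) : ℝ :=
  suq3Bracket z (fun y => F (y, p.2)) (fun y => G (y, p.2)) p.1
  + suq3Bracket z (fun y => F (p.1, y)) (fun y => G (p.1, y)) p.2

/-- Coproduct Δ(hᵢ) = hᵢ + hᵢ' (i = 0,1,2 standing for 1,2,3). -/
noncomputable def Dh (i : Fin 3) : (Fin 9 → ℝ) × (Fin 9 → ℝ) → ℝ := fun p =>
  p.1 ⟨i.val, by omega⟩ + p.2 ⟨i.val, by omega⟩

/-- Coproduct Δ(a₁₂). -/
noncomputable def Da12 (z : ℝ) : (Fin 9 → ℝ) × (Fin 9 → ℝ) → ℝ := fun p =>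
  Real.exp (z * (p.1 0 - p.1 1) / 2) * p.2 3
  + p.1 3 * Real.exp (-(z * (p.2 0 - p.2 1) / 2))

/-- Coproduct Δ(a₂₁). -/
noncomputable def Da21 (z : ℝ) : (Fin 9 → ℝ) × (Fin 9 → ℝ) → ℝ := fun p =>
  Real.exp (z * (p.1 0 - p.1 1) / 2) * p.2 4
  + p.1 4 * Real.exp (-(z * (p.2 0 - p.2 1) / 2))

/-- Coproduct Δ(a₂₃). -/
noncomputable def Da23 (z : ℝ) : (Fin 9 → ℝ) × (Fin 9 → ℝ) → ℝ := fun p =>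
  Real.exp (z * (p.1 1 - p.1 2) / 2) * p.2 5
  + p.1 5 * Real.exp (-(z * (p.2 1 - p.2 2) / 2))

/-- Coproduct Δ(a₃₂). -/
noncomputable def Da32 (z : ℝ) : (Fin 9 → ℝ) × (Fin 9 → ℝ) → ℝ := fun p =>
  Real.exp (z * (p.1 1 - p.1 2) / 2) * p.2 6
  + p.1 6 * Real.exp (-(z * (p.2 1 - p.2 2) / 2))

/-- Coproduct Δ(a₁₃). -/
noncomputable def Da13 (z : ℝ) : (Fin 9 → ℝ) × (Fin 9 → ℝ) → ℝ := fun p =>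
  Real.exp (z * (p.1 0 - p.1 2) / 2) * p.2 7
  + p.1 7 * Real.exp (-(z * (p.2 0 - p.2 2) / 2))
  + z * (Real.exp (z * (p.1 1 - p.1 2) / 2) * p.1 3
           * (Real.exp (-(z * (p.2 0 - p.2 1) / 2)) * p.2 5)
         - Real.exp (z * (p.1 0 - p.1 1) / 2) * p.1 5
           * (Real.exp (-(z * (p.2 1 - p.2 2) / 2)) * p.2 3))

/-- Coproduct Δ(a₃₁). -/
noncomputable def Da31 (z : ℝ) : (Fin 9 → ℝ) × (Fin 9 → ℝ) → ℝ := fun p =>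
  Real.exp (z * (p.1 0 - p.1 2) / 2) * p.2 8
  + p.1 8 * Real.exp (-(z * (p.2 0 - p.2 2) / 2))
  + z * (Real.exp (z * (p.1 1 - p.1 2) / 2) * p.1 4
           * (Real.exp (-(z * (p.2 0 - p.2 1) / 2)) * p.2 6)
         - Real.exp (z * (p.1 0 - p.1 1) / 2) * p.1 6
           * (Real.exp (-(z * (p.2 1 - p.2 2) / 2)) * p.2 4))

section PartialDerivatives

variable {i : Fin 9} {f g : (Fin 9 → ℝ) → ℝ} {x : Fin 9 → ℝ}

theorem pd_const (c : ℝ) : pd i (fun _ => c) x = 0 := by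
  simp [pd]

theorem pd_coord (j : Fin 9) : pd i (fun y => y j) x = (Pi.single i 1 : Fin 9 → ℝ) j := by
  have h : HasFDerivAt (fun y : Fin 9 → ℝ => y j)
      (ContinuousLinearMap.proj (R := ℝ) (φ := fun _ : Fin 9 => ℝ) j) x :=
    (ContinuousLinearMap.proj (R := ℝ) (φ := fun _ : Fin 9 => ℝ) j).hasFDerivAt
  rw [pd, h.fderiv]
  simp

theorem pd_add (hf : DifferentiableAt ℝ f x) (hg : DifferentiableAt ℝ g x) :
    pd i (fun y => f y + g y) x = pd i f x + pd i g x := by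
  simp [pd, fderiv_fun_add hf hg]

theorem pd_sub (hf : DifferentiableAt ℝ f x) (hg : DifferentiableAt ℝ g x) :
    pd i (fun y => f y - g y) x = pd i f x - pd i g x := by
  simp [pd, fderiv_fun_sub hf hg]

theorem pd_neg : pd i (fun y => -f y) x = -pd i f x := by
  simp [pd, fderiv_fun_neg]

theorem pd_mul (hf : DifferentiableAt ℝ f x) (hg : DifferentiableAt ℝ g x) :
    pd i (fun y => f y * g y) x = f x * pd i g x + g x * pd i f x := by
  simp [pd, fderiv_fun_mul hf hg]

theorem pd_div_const (hf : DifferentiableAt ℝ f x) (c : ℝ) :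
    pd i (fun y => f y / c) x = pd i f x / c := by
  simp only [div_eq_mul_inv]
  rw [pd_mul hf (differentiableAt_const _), pd_const]
  ring

theorem pd_exp (hf : DifferentiableAt ℝ f x) :
    pd i (fun y => Real.exp (f y)) x = Real.exp (f x) * pd i f x := by
  simp [pd, fderiv_exp hf]

end PartialDerivatives

/-- The bracket as a sum over the nonzero structure functions. -/
theorem suq3Bracket_eq (z : ℝ) (f g : (Fin 9 → ℝ) → ℝ) (x : Fin 9 → ℝ) :
    suq3Bracket z f g x =
      piU z 0 3 x * (pd 0 f x * pd 3 g x - pd 3 f x * pd 0 g x)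
      + piU z 0 4 x * (pd 0 f x * pd 4 g x - pd 4 f x * pd 0 g x)
      + piU z 0 7 x * (pd 0 f x * pd 7 g x - pd 7 f x * pd 0 g x)
      + piU z 0 8 x * (pd 0 f x * pd 8 g x - pd 8 f x * pd 0 g x)
      + piU z 1 3 x * (pd 1 f x * pd 3 g x - pd 3 f x * pd 1 g x)
      + piU z 1 4 x * (pd 1 f x * pd 4 g x - pd 4 f x * pd 1 g x)
      + piU z 1 5 x * (pd 1 f x * pd 5 g x - pd 5 f x * pd 1 g x)
      + piU z 1 6 x * (pd 1 f x * pd 6 g x - pd 6 f x * pd 1 g x)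
      + piU z 2 5 x * (pd 2 f x * pd 5 g x - pd 5 f x * pd 2 g x)
      + piU z 2 6 x * (pd 2 f x * pd 6 g x - pd 6 f x * pd 2 g x)
      + piU z 2 7 x * (pd 2 f x * pd 7 g x - pd 7 f x * pd 2 g x)
      + piU z 2 8 x * (pd 2 f x * pd 8 g x - pd 8 f x * pd 2 g x)
      + piU z 3 4 x * (pd 3 f x * pd 4 g x - pd 4 f x * pd 3 g x)
      + piU z 3 5 x * (pd 3 f x * pd 5 g x - pd 5 f x * pd 3 g x)
      + piU z 3 7 x * (pd 3 f x * pd 7 g x - pd 7 f x * pd 3 g x)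
      + piU z 3 8 x * (pd 3 f x * pd 8 g x - pd 8 f x * pd 3 g x)
      + piU z 4 6 x * (pd 4 f x * pd 6 g x - pd 6 f x * pd 4 g x)
      + piU z 4 7 x * (pd 4 f x * pd 7 g x - pd 7 f x * pd 4 g x)
      + piU z 4 8 x * (pd 4 f x * pd 8 g x - pd 8 f x * pd 4 g x)
      + piU z 5 6 x * (pd 5 f x * pd 6 g x - pd 6 f x * pd 5 g x)
      + piU z 5 7 x * (pd 5 f x * pd 7 g x - pd 7 f x * pd 5 g x)
      + piU z 5 8 x * (pd 5 f x * pd 8 g x - pd 8 f x * pd 5 g x)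
      + piU z 6 7 x * (pd 6 f x * pd 7 g x - pd 7 f x * pd 6 g x)
      + piU z 6 8 x * (pd 6 f x * pd 8 g x - pd 8 f x * pd 6 g x)
      + piU z 7 8 x * (pd 7 f x * pd 8 g x - pd 8 f x * pd 7 g x) := by
  simp [suq3Bracket, Fin.sum_univ_succ, piU]
  ring

section Coproduct

variable (z : ℝ) (i : Fin 9) (a b : Fin 9 → ℝ)

theorem pd_Da12_left :
    pd i (fun y => Da12 z (y, b)) a =
      let e := (Pi.single i 1 : Fin 9 → ℝ)
      Real.exp (z * (a 0 - a 1) / 2) * (z * (e 0 - e 1) / 2) * b 3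
        + e 3 * Real.exp (-(z * (b 0 - b 1) / 2)) := by
  unfold Da12
  simp (disch := fun_prop) only [pd_const, pd_coord, pd_add, pd_sub, pd_mul, pd_div_const, pd_exp]
  ring

theorem pd_Da12_right :
    pd i (fun y => Da12 z (a, y)) b =
      let e := (Pi.single i 1 : Fin 9 → ℝ)
      Real.exp (z * (a 0 - a 1) / 2) * e 3
        - a 3 * (Real.exp (-(z * (b 0 - b 1) / 2)) * (z * (e 0 - e 1) / 2)) := by
  unfold Da12
  simp (disch := fun_prop) only [pd_const, pd_coord, pd_add, pd_sub, pd_neg, pd_mul, pd_div_const,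
    pd_exp]
  ring

theorem pd_Da21_left :
    pd i (fun y => Da21 z (y, b)) a =
      let e := (Pi.single i 1 : Fin 9 → ℝ)
      Real.exp (z * (a 0 - a 1) / 2) * (z * (e 0 - e 1) / 2) * b 4
        + e 4 * Real.exp (-(z * (b 0 - b 1) / 2)) := by
  unfold Da21
  simp (disch := fun_prop) only [pd_const, pd_coord, pd_add, pd_sub, pd_mul, pd_div_const, pd_exp]
  ring

theorem pd_Da21_right :
    pd i (fun y => Da21 z (a, y)) b =
      let e := (Pi.single i 1 : Fin 9 → ℝ)
      Real.exp (z * (a 0 - a 1) / 2) * e 4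
        - a 4 * (Real.exp (-(z * (b 0 - b 1) / 2)) * (z * (e 0 - e 1) / 2)) := by
  unfold Da21
  simp (disch := fun_prop) only [pd_const, pd_coord, pd_add, pd_sub, pd_neg, pd_mul, pd_div_const,
    pd_exp]
  ring

theorem pd_Da23_left :
    pd i (fun y => Da23 z (y, b)) a =
      let e := (Pi.single i 1 : Fin 9 → ℝ)
      Real.exp (z * (a 1 - a 2) / 2) * (z * (e 1 - e 2) / 2) * b 5
        + e 5 * Real.exp (-(z * (b 1 - b 2) / 2)) := by
  unfold Da23
  simp (disch := fun_prop) only [pd_const, pd_coord, pd_add, pd_sub, pd_mul, pd_div_const, pd_exp]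
  ring

theorem pd_Da23_right :
    pd i (fun y => Da23 z (a, y)) b =
      let e := (Pi.single i 1 : Fin 9 → ℝ)
      Real.exp (z * (a 1 - a 2) / 2) * e 5
        - a 5 * (Real.exp (-(z * (b 1 - b 2) / 2)) * (z * (e 1 - e 2) / 2)) := by
  unfold Da23
  simp (disch := fun_prop) only [pd_const, pd_coord, pd_add, pd_sub, pd_neg, pd_mul, pd_div_const,
    pd_exp]
  ring

theorem pd_Da32_left :
    pd i (fun y => Da32 z (y, b)) a =
      let e := (Pi.single i 1 : Fin 9 → ℝ)
      Real.exp (z * (a 1 - a 2) / 2) * (z * (e 1 - e 2) / 2) * b 6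
        + e 6 * Real.exp (-(z * (b 1 - b 2) / 2)) := by
  unfold Da32
  simp (disch := fun_prop) only [pd_const, pd_coord, pd_add, pd_sub, pd_mul, pd_div_const, pd_exp]
  ring

theorem pd_Da32_right :
    pd i (fun y => Da32 z (a, y)) b =
      let e := (Pi.single i 1 : Fin 9 → ℝ)
      Real.exp (z * (a 1 - a 2) / 2) * e 6
        - a 6 * (Real.exp (-(z * (b 1 - b 2) / 2)) * (z * (e 1 - e 2) / 2)) := by
  unfold Da32
  simp (disch := fun_prop) only [pd_const, pd_coord, pd_add, pd_sub, pd_neg, pd_mul, pd_div_const,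
    pd_exp]
  ring

theorem pd_Da13_left :
    pd i (fun y => Da13 z (y, b)) a =
      let e := (Pi.single i 1 : Fin 9 → ℝ)
      Real.exp (z * (a 0 - a 2) / 2) * (z * (e 0 - e 2) / 2) * b 7
        + e 7 * Real.exp (-(z * (b 0 - b 2) / 2))
        + z * (Real.exp (z * (a 1 - a 2) / 2) * (z * (e 1 - e 2) / 2 * a 3 + e 3)
            * (Real.exp (-(z * (b 0 - b 1) / 2)) * b 5)
          - Real.exp (z * (a 0 - a 1) / 2) * (z * (e 0 - e 1) / 2 * a 5 + e 5)
            * (Real.exp (-(z * (b 1 - b 2) / 2)) * b 3)) := by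
  unfold Da13
  simp (disch := fun_prop) only [pd_const, pd_coord, pd_add, pd_sub, pd_mul, pd_div_const, pd_exp]
  ring

theorem pd_Da13_right :
    pd i (fun y => Da13 z (a, y)) b =
      let e := (Pi.single i 1 : Fin 9 → ℝ)
      Real.exp (z * (a 0 - a 2) / 2) * e 7
        - a 7 * (Real.exp (-(z * (b 0 - b 2) / 2)) * (z * (e 0 - e 2) / 2))
        + z * (Real.exp (z * (a 1 - a 2) / 2) * a 3
            * (Real.exp (-(z * (b 0 - b 1) / 2)) * (e 5 - z * (e 0 - e 1) / 2 * b 5))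
          - Real.exp (z * (a 0 - a 1) / 2) * a 5
            * (Real.exp (-(z * (b 1 - b 2) / 2)) * (e 3 - z * (e 1 - e 2) / 2 * b 3))) := by
  unfold Da13
  simp (disch := fun_prop) only [pd_const, pd_coord, pd_add, pd_sub, pd_neg, pd_mul, pd_div_const,
    pd_exp]
  ring

theorem pd_Da31_left :
    pd i (fun y => Da31 z (y, b)) a =
      let e := (Pi.single i 1 : Fin 9 → ℝ)
      Real.exp (z * (a 0 - a 2) / 2) * (z * (e 0 - e 2) / 2) * b 8
        + e 8 * Real.exp (-(z * (b 0 - b 2) / 2))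
        + z * (Real.exp (z * (a 1 - a 2) / 2) * (z * (e 1 - e 2) / 2 * a 4 + e 4)
            * (Real.exp (-(z * (b 0 - b 1) / 2)) * b 6)
          - Real.exp (z * (a 0 - a 1) / 2) * (z * (e 0 - e 1) / 2 * a 6 + e 6)
            * (Real.exp (-(z * (b 1 - b 2) / 2)) * b 4)) := by
  unfold Da31
  simp (disch := fun_prop) only [pd_const, pd_coord, pd_add, pd_sub, pd_mul, pd_div_const, pd_exp]
  ring

theorem pd_Da31_right :
    pd i (fun y => Da31 z (a, y)) b =
      let e := (Pi.single i 1 : Fin 9 → ℝ)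
      Real.exp (z * (a 0 - a 2) / 2) * e 8
        - a 8 * (Real.exp (-(z * (b 0 - b 2) / 2)) * (z * (e 0 - e 2) / 2))
        + z * (Real.exp (z * (a 1 - a 2) / 2) * a 4
            * (Real.exp (-(z * (b 0 - b 1) / 2)) * (e 6 - z * (e 0 - e 1) / 2 * b 6))
          - Real.exp (z * (a 0 - a 1) / 2) * a 6
            * (Real.exp (-(z * (b 1 - b 2) / 2)) * (e 4 - z * (e 1 - e 2) / 2 * b 4))) := by
  unfold Da31
  simp (disch := fun_prop) only [pd_const, pd_coord, pd_add, pd_sub, pd_neg, pd_mul, pd_div_const,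
    pd_exp]
  ring

end Coproduct

theorem exp_half_mul_exp_half (z a b c : ℝ) :
    Real.exp (z * (a - b) / 2) * Real.exp (z * (b - c) / 2) = Real.exp (z * (a - c) / 2) := by
  rw [← Real.exp_add]
  ring_nf

theorem exp_neg_half_mul_exp_neg_half (z a b c : ℝ) :
    Real.exp (-(z * (a - b) / 2)) * Real.exp (-(z * (b - c) / 2))
      = Real.exp (-(z * (a - c) / 2)) := by
  rw [← Real.exp_add]
  ring_nf

theorem suq3Bracket2_Da12_Da13 (z : ℝ) (p : (Fin 9 → ℝ) × (Fin 9 → ℝ)) :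
    suq3Bracket2 z (Da12 z) (Da13 z) p = z ^ 2 * Da12 z p ^ 2 * Da23 z p := by
  obtain ⟨a, b⟩ := p
  simp only [suq3Bracket2, suq3Bracket_eq, pd_Da12_left, pd_Da13_left, pd_Da12_right,
    pd_Da13_right]
  simp [piU, Da12, Da23]
  rw [← exp_half_mul_exp_half z (a 0) (a 1) (a 2),
    ← exp_neg_half_mul_exp_neg_half z (b 0) (b 1) (b 2)]
  ring

theorem suq3Bracket2_Da13_Da23 (z : ℝ) (p : (Fin 9 → ℝ) × (Fin 9 → ℝ)) :
    suq3Bracket2 z (Da13 z) (Da23 z) p = z ^ 2 * Da23 z p ^ 2 * Da12 z p := by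
  obtain ⟨a, b⟩ := p
  simp only [suq3Bracket2, suq3Bracket_eq, pd_Da13_left, pd_Da23_left, pd_Da13_right,
    pd_Da23_right]
  simp [piU, Da12, Da23]
  rw [← exp_half_mul_exp_half z (a 0) (a 1) (a 2),
    ← exp_neg_half_mul_exp_neg_half z (b 0) (b 1) (b 2)]
  ring

theorem suq3Bracket2_Da31_Da21 (z : ℝ) (p : (Fin 9 → ℝ) × (Fin 9 → ℝ)) :
    suq3Bracket2 z (Da31 z) (Da21 z) p = z ^ 2 * Da21 z p ^ 2 * Da32 z p := by
  obtain ⟨a, b⟩ := p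
  simp only [suq3Bracket2, suq3Bracket_eq, pd_Da31_left, pd_Da21_left, pd_Da31_right,
    pd_Da21_right]
  simp [piU, Da21, Da32]
  rw [← exp_half_mul_exp_half z (a 0) (a 1) (a 2),
    ← exp_neg_half_mul_exp_neg_half z (b 0) (b 1) (b 2)]
  ring

theorem suq3Bracket2_Da32_Da31 (z : ℝ) (p : (Fin 9 → ℝ) × (Fin 9 → ℝ)) :
    suq3Bracket2 z (Da32 z) (Da31 z) p = z ^ 2 * Da32 z p ^ 2 * Da21 z p := by
  obtain ⟨a, b⟩ := p
  simp only [suq3Bracket2, suq3Bracket_eq, pd_Da32_left, pd_Da31_left, pd_Da32_right,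
    pd_Da31_right]
  simp [piU, Da21, Da32]
  rw [← exp_half_mul_exp_half z (a 0) (a 1) (a 2),
    ← exp_neg_half_mul_exp_neg_half z (b 0) (b 1) (b 2)]
  ring

theorem suq3Bracket2_Da23_Da21 (z : ℝ) (p : (Fin 9 → ℝ) × (Fin 9 → ℝ)) :
    suq3Bracket2 z (Da23 z) (Da21 z) p = 0 := by
  obtain ⟨a, b⟩ := p
  simp only [suq3Bracket2, suq3Bracket_eq, pd_Da23_left, pd_Da21_left, pd_Da23_right,
    pd_Da21_right]
  simp [piU]
  ring

theorem suq3Bracket2_Da12_Da32 (z : ℝ) (p : (Fin 9 → ℝ) × (Fin 9 → ℝ)) :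
    suq3Bracket2 z (Da12 z) (Da32 z) p = 0 := by
  obtain ⟨a, b⟩ := p
  simp only [suq3Bracket2, suq3Bracket_eq, pd_Da12_left, pd_Da32_left, pd_Da12_right,
    pd_Da32_right]
  simp [piU]
  ring

/-- the su_q^P(3) coproduct respects the Serre-type brackets. -/
theorem suq3_coproduct_serre (z : ℝ) (hz : z ≠ 0) :
    (∀ p : (Fin 9 → ℝ) × (Fin 9 → ℝ),
      suq3Bracket2 z (Da12 z) (Da13 z) p = z ^ 2 * Da12 z p ^ 2 * Da23 z p) ∧
    (∀ p : (Fin 9 → ℝ) × (Fin 9 → ℝ),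
      suq3Bracket2 z (Da13 z) (Da23 z) p = z ^ 2 * Da23 z p ^ 2 * Da12 z p) ∧
    (∀ p : (Fin 9 → ℝ) × (Fin 9 → ℝ),
      suq3Bracket2 z (Da31 z) (Da21 z) p = z ^ 2 * Da21 z p ^ 2 * Da32 z p) ∧
    (∀ p : (Fin 9 → ℝ) × (Fin 9 → ℝ),
      suq3Bracket2 z (Da32 z) (Da31 z) p = z ^ 2 * Da32 z p ^ 2 * Da21 z p) ∧
    (∀ p : (Fin 9 → ℝ) × (Fin 9 → ℝ),
      suq3Bracket2 z (Da23 z) (Da21 z) p = 0) ∧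
    (∀ p : (Fin 9 → ℝ) × (Fin 9 → ℝ),
      suq3Bracket2 z (Da12 z) (Da32 z) p = 0) := by
  exact ⟨suq3Bracket2_Da12_Da13 z, suq3Bracket2_Da13_Da23 z, suq3Bracket2_Da31_Da21 z,
    suq3Bracket2_Da32_Da31 z, suq3Bracket2_Da23_Da21 z, suq3Bracket2_Da12_Da32 z⟩
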